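/- For every real number A > 0, there exist infinitely many prime numbers p such that there are positive integers m and n with m² dividing p + 2, n² dividing p − 2, m > (log p)^A and n > (log p)^A. Equivalently, for every A > 0 and every bound X, there is a prime p > X such that p + 2 has a square factor larger than (log p)^A and p − 2 has a square factor larger than (log p)^A. -/

import Mathlib

open Filter Topology

theorem LSeries.logMul_iterate_apply (f : ℕ → ℂ) (j n : ℕ) :
    LSeries.logMul^[j] f n = (Real.log n : ℂ) ^ j * f n := by
  induction j generalizing f with
  | zero => simp
  | succ j ih =>
    rw [Function.iterate_succ_apply, ih, LSeries.logMul, ← Complex.natCast_log]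
    ring

theorem norm_sum_range_mul_le_of_antitone {c : ℕ → ℂ} {f : ℕ → ℝ} {Q : ℝ}
    (hc : ∀ n, ‖∑ i ∈ Finset.range n, c i‖ ≤ Q) (hf : Antitone f) (hf0 : ∀ n, 0 ≤ f n) (n : ℕ) :
    ‖∑ i ∈ Finset.range n, c i * f i‖ ≤ Q * f 0 := by
  have key : ∑ i ∈ Finset.range n, c i * f i = (∑ i ∈ Finset.range n, c i) * f n +
      ∑ i ∈ Finset.range n,
        (∑ k ∈ Finset.range (i + 1), c k) * ((f i - f (i + 1) : ℝ) : ℂ) := by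
    induction n with
    | zero => simp
    | succ n ih =>
      rw [Finset.sum_range_succ, ih, Finset.sum_range_succ (n := n)
        (f := fun i ↦ (∑ k ∈ Finset.range (i + 1), c k) * ((f i - f (i + 1) : ℝ) : ℂ)),
        Finset.sum_range_succ (n := n) (f := c)]
      push_cast
      ring
  rw [key]
  calc _ ≤ Q * f n + ∑ i ∈ Finset.range n, Q * (f i - f (i + 1)) := by
        refine (norm_add_le _ _).trans (add_le_add ?_ ((norm_sum_le _ _).trans ?_))
        · rw [norm_mul, Complex.norm_real, Real.norm_of_nonneg (hf0 n)]
          exact mul_le_mul_of_nonneg_right (hc n) (hf0 n)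
        · refine Finset.sum_le_sum fun i _ ↦ ?_
          have : 0 ≤ f i - f (i + 1) := sub_nonneg.2 (hf i.le_succ)
          rw [norm_mul, Complex.norm_real, Real.norm_of_nonneg this]
          exact mul_le_mul_of_nonneg_right (hc _) this
    _ = Q * f 0 := by
        rw [← Finset.mul_sum, Finset.sum_range_sub']
        ring

theorem antitoneOn_log_pow_div_rpow (j : ℕ) {x : ℝ} (hx : 1 ≤ x) :
    AntitoneOn (fun t : ℝ ↦ Real.log t ^ j / t ^ x) (Set.Ici (Real.exp j)) := by
  intro s hs t ht hst
  have hs0 : 0 < s := (Real.exp_pos _).trans_le hs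
  have ht0 : 0 < t := (Real.exp_pos _).trans_le ht
  rcases Nat.eq_zero_or_pos j with rfl | hj
  · simp only [pow_zero]
    gcongr
  have hj' : (0 : ℝ) < j := by exact_mod_cast hj
  have hdecomp : ∀ u : ℝ, 0 < u →
      Real.log u ^ j / u ^ x = (Real.log u / u ^ (x / j)) ^ j := by
    intro u hu
    rw [div_pow, ← Real.rpow_mul_natCast hu.le, div_mul_cancel₀ _ hj'.ne']
  have hmem : ∀ u ∈ Set.Ici (Real.exp j), u ∈ Set.Ici (Real.exp (x / j)⁻¹) := by
    intro u hu
    refine le_trans (Real.exp_le_exp.2 ?_) hu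
    rw [inv_div]
    exact div_le_self hj'.le hx
  have h1 : 1 ≤ t := (Real.one_le_exp hj'.le).trans ht
  simp only
  rw [hdecomp s hs0, hdecomp t ht0]
  have := Real.log_div_self_rpow_antitoneOn (a := x / j) (by positivity) (hmem s hs) (hmem t ht) hst
  exact pow_le_pow_left₀ (div_nonneg (Real.log_nonneg h1) (by positivity)) this j

theorem sum_range_log_pow_div_rpow_le (q j : ℕ) {x : ℝ} (hx : 1 ≤ x) :
    ∑ n ∈ Finset.range q, Real.log n ^ j / (n : ℝ) ^ x ≤
      Real.log q ^ j * (1 + Real.log q) := by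
  calc _ ≤ ∑ n ∈ Finset.range q, Real.log q ^ j * (n : ℝ)⁻¹ := by
        refine Finset.sum_le_sum fun n hn ↦ ?_
        have hnq : n < q := Finset.mem_range.1 hn
        rcases Nat.eq_zero_or_pos n with rfl | h0
        · simp [Real.zero_rpow (by linarith : x ≠ 0)]
        have h1 : (1 : ℝ) ≤ n := by exact_mod_cast h0
        have hl : Real.log n ≤ Real.log q := Real.log_le_log (by linarith) (by exact_mod_cast hnq.le)
        have hl0 := Real.log_nonneg h1
        rw [div_eq_mul_inv]
        gcongr
        simpa using Real.rpow_le_rpow_of_exponent_le h1 hx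
    _ = Real.log q ^ j * ∑ n ∈ Finset.range q, (n : ℝ)⁻¹ := by rw [Finset.mul_sum]
    _ ≤ _ := by
        have hq : 0 ≤ Real.log q := Real.log_natCast_nonneg q
        gcongr
        refine le_trans ?_ (harmonic_le_one_add_log q)
        rw [harmonic]
        push_cast
        refine (Finset.sum_le_sum_of_subset_of_nonneg (Finset.range_mono q.le_succ)
          fun i _ _ ↦ by positivity).trans ?_
        rw [Finset.sum_range_succ']
        simp

namespace DirichletCharacter

variable {q : ℕ}

theorem sum_range_level_eq_zero [NeZero q] {χ : DirichletCharacter ℂ q} (hχ : χ ≠ 1) :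
    ∑ i ∈ Finset.range q, χ (i : ZMod q) = 0 := by
  rw [← MulChar.sum_eq_zero_of_ne_one hχ]
  refine Finset.sum_bij' (fun i _ ↦ (i : ZMod q)) (fun a _ ↦ a.val) ?_ ?_ ?_ ?_ ?_
  · simp
  · intro a _
    exact Finset.mem_range.2 a.val_lt
  · intro i hi
    exact ZMod.val_cast_of_lt (Finset.mem_range.1 hi)
  · simp
  · simp

theorem norm_sum_range_le [NeZero q] {χ : DirichletCharacter ℂ q} (hχ : χ ≠ 1) (n : ℕ) :
    ‖∑ i ∈ Finset.range n, χ (i : ZMod q)‖ ≤ q := by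
  induction n using Nat.strong_induction_on with
  | _ n ih =>
    rcases lt_or_ge n q with h | h
    · refine (norm_sum_le _ _).trans ((Finset.sum_le_sum fun i _ ↦ χ.norm_le_one _).trans ?_)
      simpa using h.le
    · obtain ⟨m, rfl⟩ := Nat.exists_eq_add_of_le h
      rw [Finset.sum_range_add, sum_range_level_eq_zero hχ, zero_add]
      simpa using ih m (by have := NeZero.pos q; omega)

theorem norm_LSeries_logMul_iterate_le [NeZero q] {χ : DirichletCharacter ℂ q} (hχ : χ ≠ 1)
    (j : ℕ) (hj : Real.exp j ≤ q) {x : ℝ} (hx : 1 < x) :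
    ‖LSeries (LSeries.logMul^[j] (fun n ↦ χ n)) x‖ ≤ (3 + Real.log q) ^ (j + 1) := by
  have hq0 : (0 : ℝ) < q := by exact_mod_cast NeZero.pos q
  have hq1 : (1 : ℝ) ≤ q := by exact_mod_cast NeZero.pos q
  have hlq : 0 ≤ Real.log q := Real.log_nonneg hq1
  set f : ℕ → ℝ := fun n ↦ Real.log n ^ j / (n : ℝ) ^ x with hf
  have hf0 : ∀ n, 0 ≤ f n := fun n ↦
    div_nonneg (pow_nonneg (Real.log_natCast_nonneg n) _) (by positivity)
  have hterm : ∀ n : ℕ, LSeries.term (LSeries.logMul^[j] (fun n ↦ χ n)) x n = χ n * f n := by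
    intro n
    rcases eq_or_ne n 0 with rfl | hn
    · simp [hf, Real.zero_rpow (by linarith : x ≠ 0)]
    · rw [LSeries.term_of_ne_zero hn, LSeries.logMul_iterate_apply, hf]
      simp only
      rw [Complex.ofReal_div, Complex.ofReal_cpow (Nat.cast_nonneg n)]
      push_cast
      ring
  have hsum : Summable (LSeries.term (LSeries.logMul^[j] (fun n ↦ χ n)) x) := by
    apply LSeriesSummable_of_abscissaOfAbsConv_lt_re
    rw [LSeries.absicssaOfAbsConv_logPowMul, absicssaOfAbsConv_eq_one (NeZero.ne q)]
    exact_mod_cast hx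
  have hlim := hsum.hasSum.tendsto_sum_nat.norm
  refine le_of_tendsto hlim ?_
  filter_upwards [eventually_ge_atTop q] with N hN
  obtain ⟨m, rfl⟩ := Nat.exists_eq_add_of_le hN
  rw [Finset.sum_range_add]
  simp only [hterm]
  have hhead : ‖∑ n ∈ Finset.range q, χ n * (f n : ℂ)‖ ≤ Real.log q ^ j * (1 + Real.log q) := by
    refine (norm_sum_le _ _).trans (le_trans (Finset.sum_le_sum fun n _ ↦ ?_)
      (sum_range_log_pow_div_rpow_le q j hx.le))
    rw [norm_mul, Complex.norm_real, Real.norm_of_nonneg (hf0 n)]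
    exact mul_le_of_le_one_left (hf0 n) (χ.norm_le_one _)
  have htail : ‖∑ n ∈ Finset.range m, χ ((q + n : ℕ) : ZMod q) * (f (q + n) : ℂ)‖ ≤
      Real.log q ^ j := by
    refine (norm_sum_range_mul_le_of_antitone (Q := q) (f := fun n ↦ f (q + n)) ?_ ?_ ?_ m).trans ?_
    · intro n
      simpa using norm_sum_range_le hχ n
    · intro a b hab
      have hle : ∀ c : ℕ, Real.exp j ≤ ((q + c : ℕ) : ℝ) := fun c ↦ by
        push_cast; linarith [(Nat.cast_nonneg c : (0 : ℝ) ≤ c)]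
      exact antitoneOn_log_pow_div_rpow j hx.le (hle a) (hle b) (by exact_mod_cast (by omega))
    · exact fun n ↦ hf0 _
    · simp only [add_zero, hf]
      rw [mul_div_assoc', div_le_iff₀ (by positivity), mul_comm]
      gcongr
      simpa using Real.rpow_le_rpow_of_exponent_le hq1 hx.le
  calc _ ≤ Real.log q ^ j * (1 + Real.log q) + Real.log q ^ j :=
        (norm_add_le _ _).trans (add_le_add hhead htail)
    _ = Real.log q ^ j * (2 + Real.log q) := by ring
    _ ≤ (3 + Real.log q) ^ j * (3 + Real.log q) := by
        gcongr <;> linarith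
    _ = _ := by ring

end DirichletCharacter

theorem exists_forall_tsum_one_div_rpow_le :
    ∃ x₁ : ℝ, 0 < x₁ ∧ ∀ x : ℝ, 0 < x → x < x₁ → ∑' n : ℕ, 1 / (n : ℝ) ^ (1 + x) ≤ 2 / x := by
  have h := tendsto_sub_mul_tsum_nat_rpow.eventually_le_const (one_lt_two : (1 : ℝ) < 2)
  obtain ⟨u, hu, hsub⟩ := mem_nhdsGT_iff_exists_Ioo_subset.1 h
  refine ⟨u - 1, sub_pos.2 hu, fun x hx hxu ↦ ?_⟩
  have := hsub (show 1 + x ∈ Set.Ioo 1 u from ⟨by linarith, by linarith⟩)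
  simp only [Set.mem_ofPred_eq, add_sub_cancel_left] at this
  rwa [le_div_iff₀' hx]

theorem exists_norm_iteratedDeriv_logDeriv_le (j : ℕ) :
    ∃ e : ℕ, ∀ (G L : ℂ → ℂ) (s : ℂ) (B : ℝ), 2 ≤ B → AnalyticAt ℂ G s → AnalyticAt ℂ L s →
      (∀ i ≤ j, iteratedDeriv i (G * L) s = -iteratedDeriv (i + 1) L s) →
      (∀ i ≤ j + 1, ‖iteratedDeriv i L s‖ ≤ B) → 1 ≤ B * ‖L s‖ →
      ∀ i ≤ j, ‖iteratedDeriv i G s‖ ≤ B ^ e := by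
  induction j with
  | zero =>
    refine ⟨2, fun G L s B hB _ _ hGL hL hL0 i hi ↦ ?_⟩
    obtain rfl : i = 0 := by omega
    have h0 := hGL 0 le_rfl
    simp only [iteratedDeriv_zero, Pi.mul_apply] at h0 ⊢
    have h1 := hL 1 le_rfl
    have h2 : ‖G s‖ * ‖L s‖ ≤ B := by
      rw [← norm_mul, h0, norm_neg]
      simpa using h1
    have h3 := norm_nonneg (G s)
    calc ‖G s‖ ≤ ‖G s‖ * (B * ‖L s‖) := le_mul_of_one_le_right h3 hL0
      _ = B * (‖G s‖ * ‖L s‖) := by ring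
      _ ≤ B * B := by gcongr
      _ = B ^ 2 := by ring
  | succ j ih =>
    obtain ⟨e, he⟩ := ih
    refine ⟨2 * j + e + 6, fun G L s B hB hG hL' hGL hL hL0 i hi ↦ ?_⟩
    have hB1 : 1 ≤ B := by linarith
    have hprev := he G L s B hB hG hL' (fun i hi ↦ hGL i (by omega)) (fun i hi ↦ hL i (by omega)) hL0
    rcases Nat.lt_or_ge i (j + 1) with h | h
    · exact (hprev i (by omega)).trans (pow_le_pow_right₀ hB1 (by omega))
    obtain rfl : i = j + 1 := by omega
    have h0 := hGL (j + 1) le_rfl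
    rw [iteratedDeriv_mul hG.contDiffAt hL'.contDiffAt, Finset.sum_range_succ] at h0
    simp only [Nat.choose_self, Nat.cast_one, one_mul, Nat.sub_self, iteratedDeriv_zero] at h0
    have hS : ‖∑ i ∈ Finset.range (j + 1),
        ((j + 1).choose i : ℂ) * iteratedDeriv i G s * iteratedDeriv (j + 1 - i) L s‖ ≤
        B ^ (2 * j + e + 3) := by
      refine (norm_sum_le _ _).trans ?_
      calc _ ≤ ∑ i ∈ Finset.range (j + 1), B ^ (j + 1) * B ^ e * B := by
            refine Finset.sum_le_sum fun i hi ↦ ?_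
            have hij := Finset.mem_range.1 hi
            rw [norm_mul, norm_mul, Complex.norm_natCast]
            have hc : ((j + 1).choose i : ℝ) ≤ B ^ (j + 1) := by
              calc ((j + 1).choose i : ℝ) ≤ 2 ^ (j + 1) := by
                    exact_mod_cast Nat.choose_le_two_pow (j + 1) i
                _ ≤ _ := by gcongr
            gcongr
            · exact hprev i (by omega)
            · exact hL _ (by omega)
        _ = (j + 1 : ℝ) * (B ^ (j + 1) * B ^ e * B) := by simp
        _ ≤ B ^ (j + 1) * (B ^ (j + 1) * B ^ e * B) := by
            gcongr
            calc (j + 1 : ℝ) ≤ 2 ^ (j + 1) := by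
                  exact_mod_cast (Nat.lt_two_pow_self (n := j + 1)).le
              _ ≤ _ := by gcongr
        _ = _ := by ring
    have h1 : ‖iteratedDeriv (j + 1) G s‖ * ‖L s‖ ≤ B + B ^ (2 * j + e + 3) := by
      rw [← norm_mul, eq_sub_of_add_eq' h0]
      refine (norm_sub_le _ _).trans (add_le_add ?_ hS)
      rw [norm_neg]
      exact hL _ le_rfl
    have h3 := norm_nonneg (iteratedDeriv (j + 1) G s)
    calc ‖iteratedDeriv (j + 1) G s‖ ≤ ‖iteratedDeriv (j + 1) G s‖ * (B * ‖L s‖) :=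
          le_mul_of_one_le_right h3 hL0
      _ = B * (‖iteratedDeriv (j + 1) G s‖ * ‖L s‖) := by ring
      _ ≤ B * (B + B ^ (2 * j + e + 3)) := by gcongr
      _ ≤ B * (B ^ (2 * j + e + 3) + B ^ (2 * j + e + 3)) := by
          gcongr
          exact le_self_pow₀ hB1 (by omega)
      _ = 2 * B ^ (2 * j + e + 4) := by ring
      _ ≤ B * B ^ (2 * j + e + 4) := by gcongr
      _ = B ^ (2 * j + e + 5) := by ring
      _ ≤ _ := pow_le_pow_right₀ hB1 (by omega)

namespace DirichletCharacter

variable {q : ℕ}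

theorem norm_LSeries_le_tsum [NeZero q] (χ : DirichletCharacter ℂ q) {x : ℝ} (hx : 1 < x) :
    ‖LSeries (fun n ↦ χ n) x‖ ≤ ∑' n : ℕ, 1 / (n : ℝ) ^ x := by
  refine tsum_of_norm_bounded (Real.summable_one_div_nat_rpow.2 hx).hasSum fun n ↦ ?_
  rw [LSeries.norm_term_eq]
  split_ifs with h
  · positivity
  · simp only [Complex.ofReal_re]
    gcongr
    exact χ.norm_le_one _

theorem norm_LSeries_sub_le [NeZero q] {χ : DirichletCharacter ℂ q} (hχ : χ ≠ 1)
    (hq : Real.exp 1 ≤ q) {x y : ℝ} (hx : 1 < x) (hxy : x ≤ y) :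
    ‖LSeries (fun n ↦ χ n) y - LSeries (fun n ↦ χ n) x‖ ≤ (3 + Real.log q) ^ 2 * (y - x) := by
  have key := Convex.norm_image_sub_le_of_norm_hasDerivWithin_le (s := Set.Ioi (1 : ℝ))
    (f := fun t : ℝ ↦ LSeries (fun n ↦ χ n) t)
    (f' := fun t : ℝ ↦ -LSeries (LSeries.logMul (fun n ↦ χ n)) t) (C := (3 + Real.log q) ^ 2)
    (fun t ht ↦ ?_) (fun t ht ↦ ?_) (convex_Ioi 1) hx (show 1 < y by linarith)
  · rwa [Real.norm_of_nonneg (by linarith)] at key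
  · refine (HasDerivAt.comp_ofReal (LSeries_hasDerivAt ?_)).hasDerivWithinAt
    rw [absicssaOfAbsConv_eq_one (NeZero.ne q)]
    exact_mod_cast ht
  · rw [norm_neg]
    exact norm_LSeries_logMul_iterate_le hχ 1 (by simpa using hq) ht

theorem one_le_mul_norm_LSeries [NeZero q] {χ : DirichletCharacter ℂ q} (hχ : χ ^ 2 ≠ 1)
    (hq : Real.exp 1 ≤ q) {D δ : ℝ} (hD : D = 3 + Real.log q)
    (hζ : ∑' n : ℕ, 1 / (n : ℝ) ^ (1 + (D ^ 17)⁻¹) ≤ 2 / (D ^ 17)⁻¹)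
    (hδ : 0 < δ) (hδD : δ ≤ (D ^ 17)⁻¹) :
    1 ≤ D ^ 15 * ‖LSeries (fun n ↦ χ n) (1 + δ : ℝ)‖ := by
  have hχ1 : χ ≠ 1 := by
    rintro rfl
    simp at hχ
  have hD3 : 3 ≤ D := by
    rw [hD]
    linarith [Real.log_natCast_nonneg q]
  have hD0 : 0 < D := by linarith
  set x₀ := (D ^ 17)⁻¹ with hx₀
  have hx₀pos : 0 < x₀ := by positivity
  by_contra! hlt
  have hdiff := norm_LSeries_sub_le hχ1 hq (x := 1 + δ) (y := 1 + x₀) (by linarith) (by linarith)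
  rw [← hD] at hdiff
  have hL : ‖LSeries (fun n ↦ χ n) (1 + x₀ : ℝ)‖ * D ^ 14 ≤ 1 := by
    have h1 : ‖LSeries (fun n ↦ χ n) (1 + x₀ : ℝ)‖ ≤
        D ^ 2 * x₀ + ‖LSeries (fun n ↦ χ n) (1 + δ : ℝ)‖ := by
      have h2 := norm_sub_norm_le (LSeries (fun n ↦ χ n) (1 + x₀ : ℝ))
        (LSeries (fun n ↦ χ n) (1 + δ : ℝ))
      nlinarith [mul_pos (pow_pos hD0 2) hδ]
    have h3 : D ^ 15 * (D ^ 2 * x₀) = 1 := by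
      rw [hx₀]
      field_simp
    have h4 : ‖LSeries (fun n ↦ χ n) (1 + x₀ : ℝ)‖ * D ^ 14 * D ≤ 2 := by
      calc _ = D ^ 15 * ‖LSeries (fun n ↦ χ n) (1 + x₀ : ℝ)‖ := by ring
        _ ≤ D ^ 15 * (D ^ 2 * x₀ + ‖LSeries (fun n ↦ χ n) (1 + δ : ℝ)‖) := by gcongr
        _ ≤ 2 := by rw [mul_add]; linarith
    have h5 : 0 ≤ ‖LSeries (fun n ↦ χ n) (1 + x₀ : ℝ)‖ * D ^ 14 := by positivity
    nlinarith
  have hprod := norm_LSeries_product_ge_one χ hx₀pos 0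
  simp only [Complex.ofReal_zero, mul_zero, add_zero] at hprod
  rw [show (1 + (x₀ : ℂ)) = ((1 + x₀ : ℝ) : ℂ) by push_cast; ring, norm_mul, norm_mul, norm_pow,
    norm_pow] at hprod
  have hb1 : ‖LSeries (fun n ↦ (1 : DirichletCharacter ℂ q) n) (1 + x₀ : ℝ)‖ ≤ D ^ 18 := by
    refine (norm_LSeries_le_tsum 1 (by linarith)).trans (hζ.trans ?_)
    rw [hx₀, div_inv_eq_mul]
    calc 2 * D ^ 17 ≤ D * D ^ 17 := by gcongr; linarith
      _ = _ := by ring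
  have hb2 : ‖LSeries (fun n ↦ (χ ^ 2) n) (1 + x₀ : ℝ)‖ ≤ D := by
    have := norm_LSeries_logMul_iterate_le hχ 0 (by
      simpa using (Real.one_le_exp zero_le_one).trans hq) (x := 1 + x₀) (by linarith)
    simpa [← hD] using this
  have : (1 : ℝ) ≤ (D ^ 18) ^ 3 * ((D ^ 14)⁻¹) ^ 4 * D := by
    refine hprod.trans ?_
    gcongr
    rwa [← one_div, le_div_iff₀ (by positivity)]
  have h6 : (D ^ 18) ^ 3 * ((D ^ 14)⁻¹) ^ 4 * D = D⁻¹ := by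
    field_simp
  rw [h6] at this
  have : D⁻¹ < 1 := inv_lt_one_of_one_lt₀ (by linarith)
  linarith

theorem exists_norm_tsum_twist_le (K : ℕ) :
    ∃ e : ℕ, ∀ (q : ℕ) [NeZero q] (χ : DirichletCharacter ℂ q) (D δ : ℝ), χ ^ 2 ≠ 1 →
      Real.exp (K + 1) ≤ q → D = 3 + Real.log q →
      ∑' n : ℕ, 1 / (n : ℝ) ^ (1 + (D ^ 17)⁻¹) ≤ 2 / (D ^ 17)⁻¹ →
      0 < δ → δ ≤ (D ^ 17)⁻¹ →
      ‖∑' n : ℕ, χ n *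
        ((ArithmeticFunction.vonMangoldt n * Real.log n ^ K / (n : ℝ) ^ (1 + δ) : ℝ) : ℂ)‖ ≤
        D ^ e := by
  obtain ⟨e, he⟩ := exists_norm_iteratedDeriv_logDeriv_le K
  refine ⟨(K + 17) * e, fun q _ χ D δ hχ hq hD hζ hδ hδD ↦ ?_⟩
  have hχ1 : χ ≠ 1 := by
    rintro rfl
    simp at hχ
  have hD3 : 3 ≤ D := by
    rw [hD]
    linarith [Real.log_natCast_nonneg q]
  have hD1 : 1 ≤ D := by linarith
  have hs : 1 < ((1 + δ : ℝ) : ℂ).re := by simpa using hδ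
  set G : ℂ → ℂ := LSeries ((fun n : ℕ ↦ χ n) * fun n : ℕ ↦ (ArithmeticFunction.vonMangoldt n : ℂ))
  set L : ℂ → ℂ := LSeries (fun n : ℕ ↦ χ n)
  have hLabs : LSeries.abscissaOfAbsConv (fun n : ℕ ↦ χ n) = 1 :=
    absicssaOfAbsConv_eq_one (NeZero.ne q) χ
  have hGabs : LSeries.abscissaOfAbsConv
      ((fun n : ℕ ↦ χ n) * fun n : ℕ ↦ (ArithmeticFunction.vonMangoldt n : ℂ)) ≤ 1 := by
    refine LSeries.abscissaOfAbsConv_le_of_forall_lt_LSeriesSummable fun y hy ↦ ?_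
    exact LSeriesSummable_twist_vonMangoldt χ (by simpa using hy)
  have hGs : LSeries.abscissaOfAbsConv
      ((fun n : ℕ ↦ χ n) * fun n : ℕ ↦ (ArithmeticFunction.vonMangoldt n : ℂ)) <
        ((1 + δ : ℝ) : ℂ).re := hGabs.trans_lt (by exact_mod_cast hs)
  have hLs : LSeries.abscissaOfAbsConv (fun n : ℕ ↦ χ n) < ((1 + δ : ℝ) : ℂ).re := by
    rw [hLabs]; exact_mod_cast hs
  have hG : AnalyticAt ℂ G (1 + δ : ℝ) := LSeries_analyticOnNhd _ _ hGs
  have hL : AnalyticAt ℂ L (1 + δ : ℝ) := LSeries_analyticOnNhd _ _ hLs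
  have hGL : G * L =ᶠ[𝓝 ((1 + δ : ℝ) : ℂ)] -deriv L := by
    have : ∀ᶠ s : ℂ in 𝓝 ((1 + δ : ℝ) : ℂ), 1 < s.re :=
      Complex.continuous_re.continuousAt.eventually (lt_mem_nhds hs)
    filter_upwards [this] with s hs
    simp only [Pi.mul_apply, Pi.neg_apply, G, L]
    rw [LSeries_twist_vonMangoldt_eq χ hs, div_mul_cancel₀]
    exact LSeries_ne_zero_of_one_lt_re χ hs
  have hB : 2 ≤ D ^ (K + 17) := by
    calc 2 ≤ D := by linarith
      _ ≤ _ := le_self_pow₀ hD1 (by omega)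
  have hmain := he G L (1 + δ : ℝ) (D ^ (K + 17)) hB hG hL ?_ ?_ ?_ K le_rfl
  · rw [LSeries_iteratedDeriv K hGs, norm_mul, norm_pow, norm_neg, norm_one, one_pow, one_mul,
      ← pow_mul] at hmain
    convert hmain using 2
    refine tsum_congr fun n ↦ ?_
    rcases eq_or_ne n 0 with rfl | hn
    · simp
    · rw [LSeries.term_of_ne_zero hn, LSeries.logMul_iterate_apply, Complex.ofReal_div,
        Complex.ofReal_cpow (Nat.cast_nonneg n)]
      simp only [Pi.mul_apply]
      push_cast
      ring
  · intro i _
    rw [hGL.iteratedDeriv_eq, iteratedDeriv_succ', iteratedDeriv_neg]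
  · intro i hi
    rw [LSeries_iteratedDeriv i hLs, norm_mul, norm_pow, norm_neg, norm_one, one_pow, one_mul]
    have hiK : (i : ℝ) ≤ K + 1 := by exact_mod_cast hi
    refine (norm_LSeries_logMul_iterate_le hχ1 i ((Real.exp_le_exp.2 hiK).trans hq)
      (by linarith)).trans ?_
    rw [← hD]
    exact pow_le_pow_right₀ hD1 (by omega)
  · refine (one_le_mul_norm_LSeries hχ ((Real.exp_le_exp.2 (by simp)).trans hq) hD hζ hδ
      hδD).trans ?_
    gcongr
    omega

end DirichletCharacter

namespace DirichletCharacter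

theorem mem_range_changeLevel_of_sq_eq_one {b t : ℕ} (hb : _root_.Odd b) (ht : t ≠ 0)
    {χ : DirichletCharacter ℂ (b ^ t)} (hχ : χ ^ 2 = 1) :
    χ ∈ Set.range (changeLevel (R := ℂ) (dvd_pow_self b ht)) := by
  have : NeZero (b ^ t) := ⟨pow_ne_zero _ hb.pos.ne'⟩
  suffices h : χ.FactorsThrough b by
    obtain ⟨_, χ₀, h⟩ := h
    exact ⟨χ₀, h.symm⟩
  rw [factorsThrough_iff_ker_unitsMap (dvd_pow_self b ht)]
  intro u hu
  have hu1 : (b : ZMod (b ^ t)) ∣ (u : ZMod (b ^ t)) - 1 := by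
    rw [MonoidHom.mem_ker, Units.ext_iff, ZMod.unitsMap_val, Units.val_one] at hu
    obtain ⟨n, hn⟩ := ZMod.intCast_surjective (u : ZMod (b ^ t))
    rw [← hn, ZMod.cast_intCast (dvd_pow_self b ht)] at hu
    rw [← hn]
    have : (b : ℤ) ∣ n - 1 := by
      rw [← ZMod.intCast_zmod_eq_zero_iff_dvd]
      push_cast
      rw [hu, sub_self]
    obtain ⟨c, hc⟩ := this
    exact ⟨(c : ZMod (b ^ t)), by exact_mod_cast congrArg (Int.cast : ℤ → ZMod (b ^ t)) hc⟩
  have hpow : u ^ b ^ t = 1 := by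
    have h1 := dvd_sub_pow_of_dvd_sub hu1 t
    have h2 : (b : ZMod (b ^ t)) ^ (t + 1) = 0 := by
      rw [pow_succ, ← Nat.cast_pow, ZMod.natCast_self, zero_mul]
    rw [h2, zero_dvd_iff, one_pow, sub_eq_zero] at h1
    exact Units.ext (by simpa using h1)
  rw [MonoidHom.mem_ker]
  have hsq : χ.toUnitHom u ^ 2 = 1 := by
    apply Units.ext
    have := congrArg (fun ψ : DirichletCharacter ℂ (b ^ t) ↦ ψ (u : ZMod (b ^ t))) hχ
    simpa only [MulChar.pow_apply_coe, MulChar.one_apply_coe, Units.val_pow_eq_pow_val,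
      MulChar.coe_toUnitHom, Units.val_one] using this
  have hodd : χ.toUnitHom u ^ b ^ t = 1 := by rw [← map_pow, hpow, map_one]
  have hcop : Nat.Coprime 2 (b ^ t) := (Nat.coprime_two_left.2 hb.pow)
  have := Nat.dvd_gcd (orderOf_dvd_of_pow_eq_one hsq) (orderOf_dvd_of_pow_eq_one hodd)
  rw [hcop.gcd_eq_one, Nat.dvd_one, orderOf_eq_one_iff] at this
  exact this

theorem changeLevel_pow_natCast {b t : ℕ} (ht : t ≠ 0) (ψ : DirichletCharacter ℂ b) (n : ℕ) :
    changeLevel (dvd_pow_self b ht) ψ (n : ZMod (b ^ t)) = ψ (n : ZMod b) := by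
  by_cases h : n.Coprime b
  · have := changeLevel_eq_cast_of_dvd' ψ (dvd_pow_self b ht) (a := (n : ℤ))
      (Nat.isCoprime_iff_coprime.2 (h.pow_right t))
    simpa using this
  · rw [MulChar.map_nonunit, MulChar.map_nonunit]
    · rwa [ZMod.isUnit_iff_coprime]
    · rw [ZMod.isUnit_iff_coprime]
      exact fun h' ↦ h (Nat.Coprime.coprime_dvd_right (dvd_pow_self b ht) h')

theorem map_inv_of_isUnit {q : ℕ} (χ : DirichletCharacter ℂ q) {a : ZMod q} (ha : IsUnit a) :
    χ a⁻¹ = (χ a)⁻¹ := by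
  refine eq_inv_of_mul_eq_one_left ?_
  rw [← map_mul, ZMod.inv_mul_of_unit a ha, map_one]

open Classical in
theorem totient_mul_ite_sub_eq_sum {b t a : ℕ} [NeZero b] (ht : t ≠ 0) (ha : a.Coprime b)
    (n : ℕ) :
    (((b ^ t).totient * (if (n : ZMod (b ^ t)) = a then 1 else 0) -
      b.totient * (if (n : ZMod b) = a then 1 else 0) : ℝ) : ℂ) =
    ∑ χ : DirichletCharacter ℂ (b ^ t) with
      χ ∉ Set.range (changeLevel (R := ℂ) (dvd_pow_self b ht)),
        χ (a : ZMod (b ^ t))⁻¹ * χ n := by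
  have hq := sum_char_inv_mul_char_eq ℂ
    ((ZMod.isUnit_iff_coprime a (b ^ t)).2 (ha.pow_right t)) (n : ZMod (b ^ t))
  have hb := sum_char_inv_mul_char_eq ℂ ((ZMod.isUnit_iff_coprime a b).2 ha) (n : ZMod b)
  have hsplit := Finset.sum_filter_add_sum_filter_not
    (Finset.univ : Finset (DirichletCharacter ℂ (b ^ t)))
    (fun χ ↦ χ ∈ Set.range (changeLevel (R := ℂ) (dvd_pow_self b ht)))
    (fun χ ↦ χ (a : ZMod (b ^ t))⁻¹ * χ n)
  have himage : ∑ χ : DirichletCharacter ℂ (b ^ t) with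
      χ ∈ Set.range (changeLevel (R := ℂ) (dvd_pow_self b ht)),
        χ (a : ZMod (b ^ t))⁻¹ * χ n =
      ∑ ψ : DirichletCharacter ℂ b, ψ (a : ZMod b)⁻¹ * ψ n := by
    have hset : (Finset.univ.filter fun χ : DirichletCharacter ℂ (b ^ t) ↦
        χ ∈ Set.range (changeLevel (R := ℂ) (dvd_pow_self b ht))) =
        Finset.univ.image (changeLevel (R := ℂ) (dvd_pow_self b ht)) := by
      ext χ
      simp
    rw [hset, Finset.sum_image fun _ _ _ _ h ↦ changeLevel_injective _ h]
    refine Finset.sum_congr rfl fun ψ _ ↦ ?_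
    rw [map_inv_of_isUnit _ ((ZMod.isUnit_iff_coprime a (b ^ t)).2 (ha.pow_right t)),
      map_inv_of_isUnit _ ((ZMod.isUnit_iff_coprime a b).2 ha), changeLevel_pow_natCast ht,
      changeLevel_pow_natCast ht]
  rw [← eq_sub_iff_add_eq', himage, hq, hb] at hsplit
  rw [hsplit]
  push_cast
  simp only [eq_comm (a := (a : ZMod b)), eq_comm (a := (a : ZMod (b ^ t)))]
  split_ifs <;> simp

theorem totient_mul_tsum_le {b t a : ℕ} (hb : _root_.Odd b) (ht : t ≠ 0) (ha : a.Coprime b)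
    {w : ℕ → ℝ} (hw : Summable w) {E : ℝ} (hE0 : 0 ≤ E)
    (hE : ∀ χ : DirichletCharacter ℂ (b ^ t), χ ^ 2 ≠ 1 → ‖∑' n : ℕ, χ n * (w n : ℂ)‖ ≤ E) :
    b.totient * ∑' n : ℕ, (if (n : ZMod b) = a then w n else 0) ≤
      (b ^ t).totient * (∑' n : ℕ, (if (n : ZMod (b ^ t)) = a then w n else 0) + E) := by
  classical
  have : NeZero b := ⟨hb.pos.ne'⟩
  have hw' : ∀ χ : DirichletCharacter ℂ (b ^ t), Summable fun n : ℕ ↦ χ n * (w n : ℂ) := by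
    intro χ
    refine Summable.of_norm_bounded hw.abs fun n ↦ ?_
    rw [norm_mul, Complex.norm_real, Real.norm_eq_abs]
    exact mul_le_of_le_one_left (abs_nonneg _) (χ.norm_le_one _)
  have hite : ∀ d : ℕ, Summable fun n : ℕ ↦ if (n : ZMod d) = a then w n else 0 := by
    intro d
    refine Summable.of_norm_bounded hw.abs fun n ↦ ?_
    split_ifs <;> simp
  have key : (((b ^ t).totient * ∑' n : ℕ, (if (n : ZMod (b ^ t)) = a then w n else 0) -
      b.totient * ∑' n : ℕ, (if (n : ZMod b) = a then w n else 0) : ℝ) : ℂ) =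
      ∑ χ : DirichletCharacter ℂ (b ^ t) with
        χ ∉ Set.range (changeLevel (R := ℂ) (dvd_pow_self b ht)),
        χ (a : ZMod (b ^ t))⁻¹ * ∑' n : ℕ, χ n * (w n : ℂ) := by
    rw [← tsum_mul_left, ← tsum_mul_left,
      ← ((hite (b ^ t)).mul_left _).tsum_sub ((hite b).mul_left _), Complex.ofReal_tsum]
    simp only [← tsum_mul_left]
    rw [← Summable.tsum_finsetSum fun χ _ ↦ (hw' χ).mul_left _]
    refine tsum_congr fun n ↦ ?_
    simp only [← mul_assoc]
    rw [← Finset.sum_mul, ← totient_mul_ite_sub_eq_sum ht ha, ← Complex.ofReal_mul]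
    congr 1
    split_ifs <;> ring
  have hnorm : ‖∑ χ : DirichletCharacter ℂ (b ^ t) with
        χ ∉ Set.range (changeLevel (R := ℂ) (dvd_pow_self b ht)),
        χ (a : ZMod (b ^ t))⁻¹ * ∑' n : ℕ, χ n * (w n : ℂ)‖ ≤ (b ^ t).totient * E := by
    refine (norm_sum_le _ _).trans ((Finset.sum_le_card_nsmul _ _ E fun χ hχ ↦ ?_).trans ?_)
    · have hχ2 : χ ^ 2 ≠ 1 := fun h ↦
        (Finset.mem_filter.1 hχ).2 (mem_range_changeLevel_of_sq_eq_one hb ht h)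
      rw [norm_mul]
      exact (mul_le_of_le_one_left (norm_nonneg _) (χ.norm_le_one _)).trans (hE χ hχ2)
    · rw [nsmul_eq_mul]
      gcongr
      rw [← card_eq_totient_of_hasEnoughRootsOfUnity ℂ (b ^ t), Nat.card_eq_fintype_card]
      exact Finset.card_filter_le _ _
  rw [← key, Complex.norm_real, Real.norm_eq_abs] at hnorm
  linarith [neg_le_of_abs_le hnorm]

end DirichletCharacter

open ArithmeticFunction in
theorem summable_vonMangoldt_mul_log_pow_div_rpow (K : ℕ) {x : ℝ} (hx : 1 < x) :
    Summable fun n : ℕ ↦ vonMangoldt n * Real.log n ^ K / (n : ℝ) ^ x := by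
  have habs : LSeries.abscissaOfAbsConv (fun n : ℕ ↦ (vonMangoldt n : ℂ)) ≤ 1 :=
    LSeries.abscissaOfAbsConv_le_of_forall_lt_LSeriesSummable fun y hy ↦
      LSeriesSummable_vonMangoldt (by simpa using hy)
  have hs : LSeriesSummable (LSeries.logMul^[K] (fun n : ℕ ↦ (vonMangoldt n : ℂ))) x := by
    apply LSeriesSummable_of_abscissaOfAbsConv_lt_re
    rw [LSeries.absicssaOfAbsConv_logPowMul]
    exact habs.trans_lt (by exact_mod_cast hx)
  refine hs.norm.congr fun n ↦ ?_
  rw [LSeries.norm_term_eq]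
  split_ifs with hn
  · simp [hn]
  · rw [LSeries.logMul_iterate_apply, norm_mul, norm_pow, Complex.norm_real, Complex.norm_real,
      Real.norm_of_nonneg (Real.log_natCast_nonneg n), Real.norm_of_nonneg vonMangoldt_nonneg,
      Complex.ofReal_re, mul_comm]

open ArithmeticFunction in
theorem sum_range_vonMangoldt_div_rpow_le {Y x : ℝ} (hY : 0 ≤ Y) (hx : 1 ≤ x) :
    ∑ n ∈ Finset.range (⌊Real.exp Y⌋₊ + 1), vonMangoldt n / (n : ℝ) ^ x ≤ Y * (1 + Y) := by
  set M := ⌊Real.exp Y⌋₊ with hM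
  have hM1 : 1 ≤ M := Nat.le_floor (by simpa using hY)
  have hM1' : (1 : ℝ) ≤ M := by exact_mod_cast hM1
  have hMY : Real.log M ≤ Y := by
    rw [Real.log_le_iff_le_exp (by linarith)]
    exact Nat.floor_le (Real.exp_pos _).le
  calc _ ≤ ∑ n ∈ Finset.range (M + 1), Y * (n : ℝ)⁻¹ := by
        refine Finset.sum_le_sum fun n hn ↦ ?_
        rcases Nat.eq_zero_or_pos n with rfl | h0
        · simp
        have h1 : (1 : ℝ) ≤ n := by exact_mod_cast h0
        have hnM : (n : ℝ) ≤ M := by exact_mod_cast Nat.lt_succ_iff.1 (Finset.mem_range.1 hn)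
        rw [div_eq_mul_inv]
        gcongr
        · exact vonMangoldt_le_log.trans ((Real.log_le_log (by linarith) hnM).trans hMY)
        · simpa using Real.rpow_le_rpow_of_exponent_le h1 hx
    _ = Y * (harmonic M : ℝ) := by
        rw [← Finset.mul_sum, Finset.sum_range_succ', harmonic]
        push_cast
        simp
    _ ≤ Y * (1 + Real.log M) := by gcongr; exact harmonic_le_one_add_log M
    _ ≤ _ := by gcongr

open ArithmeticFunction in
theorem exists_le_tsum_residueClass_log_pow {b : ℕ} [NeZero b] {a : ZMod b} (ha : IsUnit a)
    (K : ℕ) :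
    ∃ C : ℝ, ∀ Z : ℝ, 1 ≤ Z →
      (Z / 4) ^ K * ((b.totient : ℝ)⁻¹ * Z ^ 2 - C - Z / 4 * (1 + Z / 4)) ≤
        ∑' n : ℕ, (if (n : ZMod b) = a then
          vonMangoldt n * Real.log n ^ K / (n : ℝ) ^ (1 + (Z ^ 2)⁻¹) else 0) := by
  obtain ⟨C, hC⟩ := vonMangoldt.LSeries_residueClass_lower_bound ha
  refine ⟨C, fun Z hZ ↦ ?_⟩
  have hδ : 0 < (Z ^ 2)⁻¹ := by positivity
  have hδ1 : (Z ^ 2)⁻¹ ≤ 1 := inv_le_one_of_one_le₀ (one_le_pow₀ hZ)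
  set x := 1 + (Z ^ 2)⁻¹ with hx
  have hlow := hC (x := x) ⟨by linarith, by linarith⟩
  rw [hx, add_sub_cancel_left, div_inv_eq_mul, ← hx] at hlow
  have hres : ∀ n : ℕ, vonMangoldt.residueClass a n / (n : ℝ) ^ x =
      if (n : ZMod b) = a then vonMangoldt n / (n : ℝ) ^ x else 0 := by
    intro n
    rw [vonMangoldt.residueClass, Set.indicator_apply]
    simp only [Set.mem_ofPred_eq]
    split_ifs <;> simp
  simp only [hres] at hlow
  have hsum0 : Summable fun n : ℕ ↦ vonMangoldt n / (n : ℝ) ^ x := by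
    simpa using summable_vonMangoldt_mul_log_pow_div_rpow 0 (x := x) (by linarith)
  have hnn : ∀ n : ℕ, 0 ≤ vonMangoldt n / (n : ℝ) ^ x := fun n ↦
    div_nonneg vonMangoldt_nonneg (by positivity)
  have hsumK := summable_vonMangoldt_mul_log_pow_div_rpow K (x := x) (by linarith)
  have hnnK : ∀ n : ℕ, 0 ≤ vonMangoldt n * Real.log n ^ K / (n : ℝ) ^ x := fun n ↦
    div_nonneg (mul_nonneg vonMangoldt_nonneg (pow_nonneg (Real.log_natCast_nonneg n) _))
      (by positivity)
  have hite : ∀ w : ℕ → ℝ, (∀ n, 0 ≤ w n) → Summable w →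
      Summable fun n : ℕ ↦ if (n : ZMod b) = a then w n else 0 := fun w hw hs ↦
    Summable.of_nonneg_of_le (fun n ↦ by split_ifs <;> simp [hw]) (fun n ↦ by
      split_ifs <;> simp [hw]) hs
  set M := ⌊Real.exp (Z / 4)⌋₊ + 1 with hM
  set v : ℕ → ℝ := fun n ↦ if n ∈ Finset.range M then vonMangoldt n / (n : ℝ) ^ x else 0 with hv
  have hvsum : Summable v := summable_of_ne_finset_zero (s := Finset.range M)
    fun n hn ↦ by simp only [hv, if_neg hn]
  have hvt : ∑' n, v n ≤ Z / 4 * (1 + Z / 4) := by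
    rw [tsum_eq_sum (s := Finset.range M) fun n hn ↦ by simp only [hv, if_neg hn]]
    refine le_trans (Finset.sum_le_sum fun n hn ↦ ?_)
      (sum_range_vonMangoldt_div_rpow_le (x := x) (by positivity) (by linarith))
    simp only [hv, if_pos hn, le_refl]
  calc _ ≤ (Z / 4) ^ K * (∑' n : ℕ, (if (n : ZMod b) = a then vonMangoldt n / (n : ℝ) ^ x else 0)
        - ∑' n, v n) := by gcongr
    _ = ∑' n : ℕ, (Z / 4) ^ K *
        ((if (n : ZMod b) = a then vonMangoldt n / (n : ℝ) ^ x else 0) - v n) := by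
        rw [← (hite _ hnn hsum0).tsum_sub hvsum, tsum_mul_left]
    _ ≤ _ := by
        refine Summable.tsum_le_tsum (fun n ↦ ?_) (((hite _ hnn hsum0).sub hvsum).mul_left _)
          (hite _ hnnK hsumK)
        have hvn : 0 ≤ v n := by
          simp only [hv]
          split_ifs <;> simp [hnn]
        split_ifs with hna
        · by_cases hnM : n ∈ Finset.range M
          · simp only [hv, if_pos hnM, sub_self, mul_zero]
            exact hnnK n
          · simp only [hv, if_neg hnM, sub_zero]
            have h1 : Real.exp (Z / 4) < n :=
              Nat.lt_of_floor_lt (by rw [Finset.mem_range] at hnM; omega)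
            have h2 : Z / 4 ≤ Real.log n :=
              (Real.le_log_iff_exp_le ((Real.exp_pos _).trans h1)).2 h1.le
            rw [mul_comm (vonMangoldt n), mul_div_assoc]
            gcongr
        · rw [zero_sub]
          exact mul_nonpos_of_nonneg_of_nonpos (by positivity) (by linarith)

theorem summable_indicator_sq_mul_cube_rpow :
    Summable ({n : ℕ | ∃ a b : ℕ, n = a ^ 2 * b ^ 3}.indicator
      fun n : ℕ ↦ (n : ℝ) ^ (-(9 / 10) : ℝ)) := by
  rw [← summable_subtype_iff_indicator]
  have hprod : Summable fun z : ℕ × ℕ ↦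
      (z.1 : ℝ) ^ (-(9 / 5) : ℝ) * (z.2 : ℝ) ^ (-(27 / 10) : ℝ) :=
    Summable.mul_of_nonneg (Real.summable_nat_rpow.2 (by norm_num))
      (Real.summable_nat_rpow.2 (by norm_num)) (fun n ↦ by positivity) (fun n ↦ by positivity)
  choose f g hfg using fun n : {n : ℕ | ∃ a b : ℕ, n = a ^ 2 * b ^ 3} ↦ n.2
  have hinj : Function.Injective fun n ↦ (f n, g n) := by
    intro m n hmn
    simp only [Prod.mk.injEq] at hmn
    exact Subtype.ext ((hfg m).trans (by rw [hmn.1, hmn.2, ← hfg n]))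
  refine (hprod.comp_injective hinj).congr fun n ↦ ?_
  simp only [Function.comp_apply]
  conv_rhs => rw [hfg n]
  push_cast
  rw [Real.mul_rpow (by positivity) (by positivity), ← Real.rpow_natCast_mul (by positivity),
    ← Real.rpow_natCast_mul (by positivity)]
  norm_num

theorem exists_eq_sq_mul_cube_of_isPrimePow {n : ℕ} (hn : IsPrimePow n) (hp : ¬ n.Prime) :
    ∃ a b : ℕ, n = a ^ 2 * b ^ 3 := by
  obtain ⟨p, k, hpp, hk, rfl⟩ := (isPrimePow_nat_iff _).1 hn
  have hk1 : k ≠ 1 := by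
    rintro rfl
    exact hp (by simpa using hpp)
  rcases Nat.even_or_odd' k with ⟨c, rfl | rfl⟩
  · exact ⟨p ^ c, 1, by ring⟩
  · obtain ⟨d, rfl⟩ : ∃ d, c = d + 1 := ⟨c - 1, by omega⟩
    exact ⟨p ^ d, p, by ring⟩

open ArithmeticFunction in
theorem exists_tsum_vonMangoldt_log_pow_le (K : ℕ) :
    ∃ C : ℝ, 0 ≤ C ∧ ∀ (Z : ℝ) (P : ℕ → Prop) [DecidablePred P], 1 ≤ Z →
      (∀ p : ℕ, p.Prime → P p → Z ^ 4 ≤ Real.log p) →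
      ∑' n : ℕ, (if P n then vonMangoldt n * Real.log n ^ K / (n : ℝ) ^ (1 + (Z ^ 2)⁻¹) else 0) ≤
        C * (1 + ∑' n : ℕ, 1 / (n : ℝ) ^ (1 + (Z ^ 2)⁻¹ / 2)) := by
  set g : ℕ → ℝ := {n : ℕ | ∃ a b : ℕ, n = a ^ 2 * b ^ 3}.indicator
      fun n : ℕ ↦ (n : ℝ) ^ (-(9 / 10) : ℝ) with hg
  have hg0 : ∀ n, 0 ≤ g n := fun n ↦ Set.indicator_nonneg (fun _ _ ↦ by positivity) n
  set C₁ : ℝ := 10 ^ (K + 1) * (K + 1).factorial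
  set C₂ : ℝ := 2 ^ (2 * K + 2) * (2 * K + 2).factorial
  have hgt : 0 ≤ ∑' n, g n := tsum_nonneg hg0
  refine ⟨C₁ * ∑' n, g n + C₂, by positivity, fun Z P _ hZ hP ↦ ?_⟩
  set δ := (Z ^ 2)⁻¹ with hδ
  have hδ0 : 0 < δ := by positivity
  have hsumζ : Summable fun n : ℕ ↦ 1 / (n : ℝ) ^ (1 + δ / 2) :=
    Real.summable_one_div_nat_rpow.2 (by linarith)
  have hpoint : ∀ n : ℕ, (if P n then vonMangoldt n * Real.log n ^ K / (n : ℝ) ^ (1 + δ) else 0) ≤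
      C₁ * g n + C₂ * (1 / (n : ℝ) ^ (1 + δ / 2)) := by
    intro n
    have hr1 : 0 ≤ C₁ * g n := mul_nonneg (by positivity) (hg0 n)
    have hr2 : 0 ≤ C₂ * (1 / (n : ℝ) ^ (1 + δ / 2)) := by positivity
    split_ifs with hPn
    swap
    · linarith
    by_cases hpp : IsPrimePow n
    swap
    · rw [vonMangoldt_eq_zero_iff.2 hpp]
      simp only [zero_mul, zero_div]
      linarith
    have hn1 : (1 : ℝ) ≤ n := by exact_mod_cast hpp.pos
    have hn0 : (0 : ℝ) < n := by linarith
    have hl0 : 0 ≤ Real.log n := Real.log_nonneg hn1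
    have hw : vonMangoldt n * Real.log n ^ K / (n : ℝ) ^ (1 + δ) ≤
        Real.log n ^ (K + 1) / (n : ℝ) ^ (1 + δ) := by
      rw [pow_succ']
      gcongr
      exact vonMangoldt_le_log
    refine hw.trans ?_
    by_cases hp : n.Prime
    · have hlog := hP n hp hPn
      set v := √(Real.log n) with hv
      have hv2 : v ^ 2 = Real.log n := Real.sq_sqrt hl0
      have hv0 : 0 ≤ v := Real.sqrt_nonneg _
      have hZv : Z ^ 2 ≤ v := Real.le_sqrt_of_sq_le (by rw [← pow_mul]; exact hlog)
      have hδv : v ≤ δ * Real.log n := by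
        rw [hδ, inv_mul_eq_div, le_div_iff₀ (by positivity), ← hv2]
        nlinarith
      have hexp := Real.pow_div_factorial_le_exp (v / 2) (by positivity) (2 * K + 2)
      have h1 : Real.log n ^ (K + 1) ≤ C₂ * (n : ℝ) ^ (δ / 2) := by
        calc Real.log n ^ (K + 1) = C₂ * ((v / 2) ^ (2 * K + 2) / (2 * K + 2).factorial) := by
              rw [← hv2, div_pow]
              simp only [C₂]
              field_simp
              ring
          _ ≤ C₂ * Real.exp (v / 2) := by gcongr
          _ ≤ C₂ * (n : ℝ) ^ (δ / 2) := by
              rw [Real.rpow_def_of_pos hn0]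
              gcongr
              linarith
      have h2 : Real.log n ^ (K + 1) / (n : ℝ) ^ (1 + δ) ≤ C₂ * (1 / (n : ℝ) ^ (1 + δ / 2)) := by
        rw [mul_one_div, div_le_div_iff₀ (by positivity) (by positivity)]
        calc _ ≤ C₂ * (n : ℝ) ^ (δ / 2) * (n : ℝ) ^ (1 + δ / 2) := by gcongr
          _ = _ := by
            rw [mul_assoc, ← Real.rpow_add hn0]
            ring_nf
      linarith
    · have hgn : g n = (n : ℝ) ^ (-(9 / 10) : ℝ) :=
        Set.indicator_of_mem (s := {n : ℕ | ∃ a b : ℕ, n = a ^ 2 * b ^ 3})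
          (exists_eq_sq_mul_cube_of_isPrimePow hpp hp) _
      have hexp := Real.pow_div_factorial_le_exp (Real.log n / 10) (by positivity) (K + 1)
      have h1 : Real.log n ^ (K + 1) ≤ C₁ * (n : ℝ) ^ (1 / 10 : ℝ) := by
        calc Real.log n ^ (K + 1) = C₁ * ((Real.log n / 10) ^ (K + 1) / (K + 1).factorial) := by
              rw [div_pow]
              simp only [C₁]
              field_simp
          _ ≤ C₁ * Real.exp (Real.log n / 10) := by gcongr
          _ = _ := by rw [Real.rpow_def_of_pos hn0]; ring_nf
      have h2 : Real.log n ^ (K + 1) / (n : ℝ) ^ (1 + δ) ≤ C₁ * g n := by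
        rw [div_le_iff₀ (by positivity), hgn]
        refine h1.trans ?_
        rw [mul_assoc C₁ ((n : ℝ) ^ (-(9 / 10) : ℝ)), ← Real.rpow_add hn0]
        gcongr
        linarith
      linarith
  have hsum : Summable fun n : ℕ ↦ C₁ * g n + C₂ * (1 / (n : ℝ) ^ (1 + δ / 2)) :=
    (summable_indicator_sq_mul_cube_rpow.mul_left _).add (hsumζ.mul_left _)
  have hnn : ∀ n : ℕ,
      0 ≤ if P n then vonMangoldt n * Real.log n ^ K / (n : ℝ) ^ (1 + δ) else 0 := by
    intro n
    split_ifs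
    · exact div_nonneg (mul_nonneg vonMangoldt_nonneg (pow_nonneg (Real.log_natCast_nonneg n) _))
        (by positivity)
    · rfl
  calc _ ≤ ∑' n : ℕ, (C₁ * g n + C₂ * (1 / (n : ℝ) ^ (1 + δ / 2))) :=
        Summable.tsum_le_tsum hpoint (Summable.of_nonneg_of_le hnn hpoint hsum) hsum
    _ = C₁ * ∑' n, g n + C₂ * ∑' n : ℕ, 1 / (n : ℝ) ^ (1 + δ / 2) := by
        rw [(summable_indicator_sq_mul_cube_rpow.mul_left _).tsum_add (hsumζ.mul_left _),
          tsum_mul_left, tsum_mul_left]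
    _ ≤ _ := by
        have h1 : 0 ≤ ∑' n : ℕ, 1 / (n : ℝ) ^ (1 + δ / 2) := tsum_nonneg fun n ↦ by positivity
        have h2 : 0 ≤ C₁ * ∑' n, g n := by positivity
        have h3 : 0 ≤ C₂ := by positivity
        nlinarith

theorem eventually_mul_pow_le_three_pow (c : ℝ) (e : ℕ) :
    ∀ᶠ l : ℕ in atTop, (c * l) ^ e ≤ 3 ^ l := by
  have h := (tendsto_pow_const_div_const_pow_of_one_lt e (by norm_num : (1 : ℝ) < 3)).const_mul
    (c ^ e)
  rw [mul_zero] at h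
  filter_upwards [h.eventually_le_const one_pos] with l hl
  rwa [← mul_div_assoc, div_le_one (by positivity), ← mul_pow] at hl

theorem three_add_log_fifteen_pow_le {R l : ℕ} (hl : 1 ≤ l) :
    3 + Real.log ((15 ^ (8 * R * l) : ℕ) : ℝ) ≤ (3 + 24 * R) * l := by
  have h15 : Real.log 15 ≤ 3 := by
    rw [Real.log_le_iff_le_exp (by norm_num)]
    have h1 := Real.exp_one_gt_d9
    calc (15 : ℝ) ≤ 2.7 ^ 3 := by norm_num
      _ ≤ Real.exp 1 ^ 3 := by gcongr; linarith
      _ = Real.exp 3 := by rw [← Real.exp_nat_mul]; norm_num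
  have hl' : (1 : ℝ) ≤ l := by exact_mod_cast hl
  push_cast
  rw [Real.log_pow]
  push_cast
  have : (8 * R * l : ℝ) * Real.log 15 ≤ 8 * R * l * 3 := by gcongr
  nlinarith

theorem eventually_exists_prime_zmod_fifteen_pow {R : ℕ} (hR : 1 ≤ R) :
    ∀ᶠ l : ℕ in atTop, ∀ a : ℕ, (a : ZMod 15) = 7 →
      ∃ p : ℕ, p.Prime ∧ (p : ZMod (15 ^ (8 * R * l))) = a ∧ Real.log p < (3 ^ l) ^ 4 := by
  set K := 20 * R + 4 with hK
  obtain ⟨e, he⟩ := DirichletCharacter.exists_norm_tsum_twist_le K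
  have h7 : IsUnit (7 : ZMod 15) := by decide
  obtain ⟨C, hC⟩ := exists_le_tsum_residueClass_log_pow h7 K
  obtain ⟨C', hC'0, hC'⟩ := exists_tsum_vonMangoldt_log_pow_le K
  obtain ⟨x₁, hx₁, hζ⟩ := exists_forall_tsum_one_div_rpow_le
  have hZlim : Tendsto (fun l : ℕ ↦ (3 : ℝ) ^ l) atTop atTop :=
    tendsto_pow_atTop_atTop_of_one_lt (by norm_num)
  filter_upwards [eventually_ge_atTop 1, eventually_mul_pow_le_three_pow (3 + 24 * R) e,
    eventually_mul_pow_le_three_pow (3 + 24 * R) 17,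
    hZlim.eventually_ge_atTop (Real.exp (K + 1)),
    hZlim.eventually_ge_atTop (20 + 16 * |C|),
    hZlim.eventually_gt_atTop ((5 * C' + 1) * 4 ^ K),
    tendsto_natCast_atTop_atTop.eventually_gt_atTop x₁⁻¹]
    with l hl1 hDe hD17 hexp hZC hZC' hlx a ha
  set Z : ℝ := 3 ^ l
  set t := 8 * R * l with ht
  have ht0 : t ≠ 0 := by positivity
  have hZ20 : 20 ≤ Z := by linarith [abs_nonneg C]
  have hZ1 : 1 ≤ Z := by linarith
  have hZsq : Z ≤ Z ^ 2 := le_self_pow₀ hZ1 two_ne_zero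
  set D : ℝ := 3 + Real.log ((15 ^ t : ℕ) : ℝ) with hD
  have hDle : D ≤ (3 + 24 * R) * l := three_add_log_fifteen_pow_le hl1
  have hD3 : 3 ≤ D := by linarith [Real.log_natCast_nonneg (15 ^ t)]
  have hDe' : D ^ e ≤ Z := (pow_le_pow_left₀ (by linarith) hDle e).trans hDe
  have hD17' : D ^ 17 ≤ Z := (pow_le_pow_left₀ (by linarith) hDle 17).trans hD17
  have hZq : Z ≤ ((15 ^ t : ℕ) : ℝ) := by
    push_cast
    calc (3 : ℝ) ^ l ≤ 15 ^ l := by gcongr; norm_num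
      _ ≤ 15 ^ t := pow_le_pow_right₀ (by norm_num) (by rw [ht]; nlinarith)
  have hqZ : ((15 ^ t : ℕ) : ℝ) ≤ Z ^ (20 * R) := by
    push_cast
    calc (15 : ℝ) ^ t = 225 ^ (4 * R * l) := by
          rw [show t = 2 * (4 * R * l) by rw [ht]; ring, pow_mul]; norm_num
      _ ≤ 243 ^ (4 * R * l) := by gcongr; norm_num
      _ = Z ^ (20 * R) := by
          rw [show (243 : ℝ) = 3 ^ 5 by norm_num, ← pow_mul, ← pow_mul]
          ring_nf
  by_contra! hno
  have hδ0 : 0 < (Z ^ 2)⁻¹ := by positivity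
  have hδD : (Z ^ 2)⁻¹ ≤ (D ^ 17)⁻¹ := by
    gcongr
    linarith
  have hDx : (D ^ 17)⁻¹ < x₁ := by
    rw [inv_lt_comm₀ (by positivity) hx₁]
    refine hlx.trans_le (le_trans ?_ (le_self_pow₀ (by linarith) (by norm_num : 17 ≠ 0)))
    have hlZ : (l : ℝ) ≤ Real.log Z := by
      have h3 : 1 ≤ Real.log 3 := by
        rw [Real.le_log_iff_exp_le (by norm_num)]
        linarith [Real.exp_one_lt_d9]
      rw [Real.log_pow]
      exact le_mul_of_one_le_right (by positivity) h3
    linarith [Real.log_le_log (by positivity) hZq]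
  have hδx : (Z ^ 2)⁻¹ / 2 < x₁ := by
    have : (Z ^ 2)⁻¹ < x₁ := hδD.trans_lt hDx
    linarith
  have hlow := hC Z hZ1
  have hup := hC' Z (fun n ↦ (n : ZMod (15 ^ t)) = a) hZ1 hno
  have hcop : a.Coprime 15 := by
    rw [← ZMod.isUnit_iff_coprime, ha]
    exact h7
  have hcmp := DirichletCharacter.totient_mul_tsum_le (b := 15) (by decide) ht0 hcop
    (summable_vonMangoldt_mul_log_pow_div_rpow K (x := 1 + (Z ^ 2)⁻¹) (by linarith))
    (E := D ^ e) (by positivity) fun χ hχ ↦ he (15 ^ t) χ D _ hχ (hexp.trans hZq) hD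
      (hζ _ (by positivity) hDx) hδ0 hδD
  rw [ha, show Nat.totient 15 = 8 by decide] at hcmp
  rw [show Nat.totient 15 = 8 by decide] at hlow
  have hζδ := hζ ((Z ^ 2)⁻¹ / 2) (by positivity) hδx
  have hbracket : 1 ≤ ((8 : ℕ) : ℝ)⁻¹ * Z ^ 2 - C - Z / 4 * (1 + Z / 4) := by
    have := le_abs_self C
    push_cast
    nlinarith
  have hlow' : (Z / 4) ^ K ≤ _ := (le_mul_of_one_le_right (by positivity) hbracket).trans hlow
  have htot : ((15 ^ t).totient : ℝ) ≤ Z ^ (20 * R) :=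
    (by exact_mod_cast Nat.totient_le _ : ((15 ^ t).totient : ℝ) ≤ ((15 ^ t : ℕ) : ℝ)).trans hqZ
  have hright : C' * (1 + ∑' n : ℕ, 1 / (n : ℝ) ^ (1 + (Z ^ 2)⁻¹ / 2)) + D ^ e ≤
      (5 * C' + 1) * Z ^ 2 := by
    have h1 : 2 / ((Z ^ 2)⁻¹ / 2) = 4 * Z ^ 2 := by field_simp; norm_num
    rw [h1] at hζδ
    have h2 : C' * (1 + ∑' n : ℕ, 1 / (n : ℝ) ^ (1 + (Z ^ 2)⁻¹ / 2)) ≤ C' * (5 * Z ^ 2) := by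
      gcongr
      linarith
    linarith
  have hfin : (Z / 4) ^ K ≤ Z ^ (20 * R) * ((5 * C' + 1) * Z ^ 2) := by
    calc (Z / 4) ^ K ≤ ((8 : ℕ) : ℝ) * (Z / 4) ^ K := by
          have : 0 ≤ (Z / 4) ^ K := by positivity
          push_cast
          linarith
      _ ≤ _ := by gcongr
      _ ≤ _ := hcmp
      _ ≤ (15 ^ t).totient * ((5 * C' + 1) * Z ^ 2) := by
          gcongr
          linarith
      _ ≤ _ := by gcongr
  rw [div_pow, div_le_iff₀ (by positivity), hK, pow_add Z] at hfin
  rw [mul_assoc] at hfin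
  have h3 := le_of_mul_le_mul_left hfin (by positivity)
  rw [← hK] at h3
  have h4 : Z ^ 2 ≤ (5 * C' + 1) * 4 ^ K := by
    refine le_of_mul_le_mul_right ?_ (by positivity : 0 < Z ^ 2)
    linarith
  linarith

/-- For every real `A > 0`, there are infinitely many primes `p` such that `p + 2` has a
square factor `m² > (log p)^(2A)` and `p - 2` has a square factor `n² > (log p)^(2A)`,
i.e. `m, n > (log p)^A`. -/
theorem infinitely_many_primes_with_large_square_factors (A : ℝ) (hA : 0 < A) :
    {p : ℕ | p.Prime ∧ ∃ m n : ℕ, 0 < m ∧ 0 < n ∧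
      (m : ℤ) ^ 2 ∣ (p : ℤ) + 2 ∧ (n : ℤ) ^ 2 ∣ (p : ℤ) - 2 ∧
      Real.log p ^ A < m ∧ Real.log p ^ A < n}.Infinite := by
  obtain ⟨R, hRA⟩ := exists_nat_ge A
  have hR : 1 ≤ R := Nat.one_le_iff_ne_zero.2 fun h ↦ by
    rw [h, Nat.cast_zero] at hRA
    linarith
  refine Set.infinite_of_forall_exists_gt fun N ↦ ?_
  obtain ⟨l, hl, hlN⟩ :=
    ((eventually_exists_prime_zmod_fifteen_pow hR).and (eventually_ge_atTop (N + 3))).exists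
  set j := 4 * R * l with hj
  have hlj : l ≤ j := by nlinarith
  have hj0 : j ≠ 0 := by omega
  have hcop : Nat.Coprime ((3 ^ j) ^ 2) ((5 ^ j) ^ 2) :=
    ((Nat.Coprime.pow j j (by norm_num : Nat.Coprime 3 5)).pow 2 2)
  obtain ⟨a, ha3, ha5⟩ := Nat.chineseRemainder hcop ((3 ^ j) ^ 2 - 2) 2
  have hN9 : N + 2 < (3 ^ j) ^ 2 :=
    calc N + 2 < j := by omega
      _ < 3 ^ j := Nat.lt_pow_self (by norm_num)
      _ ≤ (3 ^ j) ^ 2 := Nat.le_self_pow (by norm_num) _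
  have h3dvd : 3 ∣ (3 ^ j) ^ 2 := (dvd_pow_self 3 hj0).trans (dvd_pow_self _ two_ne_zero)
  have h5dvd : 5 ∣ (5 ^ j) ^ 2 := (dvd_pow_self 5 hj0).trans (dvd_pow_self _ two_ne_zero)
  have ha7 : (a : ZMod 15) = 7 := by
    have h3 : a % 3 = ((3 ^ j) ^ 2 - 2) % 3 := ha3.of_dvd h3dvd
    have h5 : a % 5 = 2 % 5 := ha5.of_dvd h5dvd
    have : a ≡ 7 [MOD 15] := by
      change a % 15 = 7 % 15
      omega
    exact_mod_cast (ZMod.natCast_eq_natCast_iff a 7 15).2 this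
  obtain ⟨p, hp, hpa, hlog⟩ := hl a ha7
  rw [ZMod.natCast_eq_natCast_iff, show 8 * R * l = j * 2 by rw [hj]; ring, pow_mul,
    show (15 : ℕ) = 3 * 5 by norm_num, mul_pow, mul_pow] at hpa
  have hp3 : (3 ^ j) ^ 2 ∣ p + 2 := by
    have h := ((hpa.of_dvd (dvd_mul_right _ _)).trans ha3).add_right 2
    rw [Nat.sub_add_cancel (by omega)] at h
    exact (Nat.modEq_zero_iff_dvd.1 (h.trans (by simp [Nat.ModEq])))
  have hp5 : ((5 ^ j : ℕ) : ℤ) ^ 2 ∣ (p : ℤ) - 2 := by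
    have h := ((hpa.of_dvd (dvd_mul_left _ _)).trans ha5).symm.dvd
    exact_mod_cast h
  have hlogA : Real.log p ^ A < 3 ^ j :=
    calc Real.log p ^ A < ((3 ^ l) ^ 4 : ℝ) ^ A :=
          Real.rpow_lt_rpow (Real.log_natCast_nonneg p) hlog hA
      _ ≤ ((3 ^ l) ^ 4 : ℝ) ^ (R : ℝ) :=
          Real.rpow_le_rpow_of_exponent_le (one_le_pow₀ (one_le_pow₀ (by norm_num))) hRA
      _ = 3 ^ j := by
          rw [Real.rpow_natCast, ← pow_mul, ← pow_mul, hj]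
          ring_nf
  refine ⟨p, ⟨hp, 3 ^ j, 5 ^ j, by positivity, by positivity, by exact_mod_cast hp3, hp5, ?_, ?_⟩,
    ?_⟩
  · exact_mod_cast hlogA
  · push_cast
    exact hlogA.trans_le (by gcongr; norm_num)
  · have := Nat.le_of_dvd (by omega) hp3
    omega
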